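/- Suppose that a group G is finitely presented relative to a collection of subgroups {H_λ}_{λ∈Λ} with finite relative generating set X and that the relative Dehn function of G with respect to {H_λ}_{λ∈Λ} is well-defined. Then the following conditions are equivalent: (1) G is hyperbolic relative to {H_λ}_{λ∈Λ}; (2) the Cayley graph Γ(G, X ∪ 𝓗) is a hyperbolic metric space. -/

import Mathlib

namespace RelHyp

variable {G : Type*} [Group G] {Λ : Type*}

/-- Length of a shortest word over the alphabet `S ∪ S⁻¹` representing `g`. -/
noncomputable def wordLength (S : Set G) (g : G) : ℕ :=
  sInf {n | ∃ w : List G, w.length = n ∧ (∀ x ∈ w, x ∈ S ∨ x⁻¹ ∈ S) ∧ w.prod = g}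

/-- The free product `F = (∗_λ H_λ) ∗ F(X)`. -/
abbrev RelFree (H : Λ → Subgroup G) (X : Set G) : Type _ :=
  Monoid.Coprod (Monoid.CoprodI fun l => ↥(H l)) (FreeGroup ↥X)

/-- The canonical homomorphism `ε : F → G`. -/
def relEps (H : Λ → Subgroup G) (X : Set G) : RelFree H X →* G :=
  Monoid.Coprod.lift (Monoid.CoprodI.lift fun l => (H l).subtype)
    (FreeGroup.lift fun x => (x : G))

/-- Letters of the alphabet `X ∪ 𝓗`, where `𝓗 = ⊔_λ (H̃_λ ∖ {1})`. -/
abbrev RelLetter (H : Λ → Subgroup G) (X : Set G) : Type _ :=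
  (Σ l : Λ, {h : ↥(H l) // h ≠ 1}) ⊕ (↥X × Bool)

/-- The image of a letter in the free product `F`. -/
def RelLetter.toF {H : Λ → Subgroup G} {X : Set G} : RelLetter H X → RelFree H X
  | Sum.inl ⟨_, h⟩ => Monoid.Coprod.inl (Monoid.CoprodI.of h.1)
  | Sum.inr (x, b) => Monoid.Coprod.inr (if b then FreeGroup.of x else (FreeGroup.of x)⁻¹)

/-- The element of `G` represented by a letter. -/
def RelLetter.val {H : Λ → Subgroup G} {X : Set G} : RelLetter H X → G
  | Sum.inl ⟨_, h⟩ => (h.1 : G)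
  | Sum.inr (x, b) => if b then (x : G) else (x : G)⁻¹

/-- The index `λ` such that the letter belongs to `H̃_λ`, if any. -/
def RelLetter.hIndex {H : Λ → Subgroup G} {X : Set G} : RelLetter H X → Option Λ
  | Sum.inl ⟨l, _⟩ => some l
  | Sum.inr _ => none

/-- The element of `F` represented by a word over `X ∪ 𝓗`. -/
def wordToF {H : Λ → Subgroup G} {X : Set G} (w : List (RelLetter H X)) : RelFree H X :=
  (w.map RelLetter.toF).prod

/-- `f` is a relative isoperimetric function of the relative presentation `⟨X, H | R⟩`. -/
def IsIsoperFn (H : Λ → Subgroup G) (X : Set G) (R : Set (RelFree H X)) (f : ℕ → ℕ) : Prop :=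
  ∀ w : List (RelLetter H X), relEps H X (wordToF w) = 1 →
    ∃ k ≤ f w.length, ∃ r c : Fin k → RelFree H X,
      (∀ i, r i ∈ R) ∧ wordToF w = (List.ofFn fun i => (c i)⁻¹ * r i * c i).prod

/-- `⟨X, H | R⟩` is a finite relative presentation of `G` w.r.t. the collection `H`. -/
structure IsFiniteRelPres (H : Λ → Subgroup G) (X : Set G) (R : Set (RelFree H X)) : Prop where
  finX : X.Finite
  finR : R.Finite
  surj : Function.Surjective (relEps H X)
  ker : (relEps H X).ker = Subgroup.normalClosure R

/-- `G` is finitely presented relative to the collection of subgroups `H`. -/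
def FinitelyPresentedRel (H : Λ → Subgroup G) : Prop :=
  ∃ (X : Set G) (R : Set (RelFree H X)), IsFiniteRelPres H X R

/-- The relative area of a word representing `1`. -/
noncomputable def relArea (H : Λ → Subgroup G) (X : Set G) (R : Set (RelFree H X))
    (w : List (RelLetter H X)) : ℕ :=
  sInf {k | ∃ r c : Fin k → RelFree H X,
    (∀ i, r i ∈ R) ∧ wordToF w = (List.ofFn fun i => (c i)⁻¹ * r i * c i).prod}

/-- The relative Dehn function of the presentation `⟨X, H | R⟩`. -/
noncomputable def relDehn (H : Λ → Subgroup G) (X : Set G) (R : Set (RelFree H X))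
    (n : ℕ) : ℕ :=
  sSup {a | ∃ w : List (RelLetter H X), w.length ≤ n ∧ relEps H X (wordToF w) = 1 ∧
    a = relArea H X R w}

/-- The relative Dehn function is well-defined (finite for each value of the argument),
i.e. there exists a finite-valued relative isoperimetric function. -/
def DehnWellDefined (H : Λ → Subgroup G) (X : Set G) (R : Set (RelFree H X)) : Prop :=
  ∃ f : ℕ → ℕ, IsIsoperFn H X R f

/-- `f ⪯ g`. -/
def AsympLE (f g : ℕ → ℕ) : Prop := ∃ C K L : ℕ, ∀ n, f n ≤ C * g (K * n) + L * n

/-- `f ∼ g`. -/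
def AsympEquiv (f g : ℕ → ℕ) : Prop := AsympLE f g ∧ AsympLE g f

/-- `G` is hyperbolic relative to `H`: it admits a finite relative presentation with a
linear relative isoperimetric function. -/
def IsRelHyperbolic (H : Λ → Subgroup G) : Prop :=
  ∃ (X : Set G) (R : Set (RelFree H X)), IsFiniteRelPres H X R ∧
    ∃ A B : ℕ, IsIsoperFn H X R fun n => A * n + B

/-- The subnegative closure of `f`. -/
noncomputable def subnegClosure (f : ℕ → ℕ) (n : ℕ) : ℕ :=
  sSup {s | ∃ L : List ℕ, (∀ a ∈ L, 0 < a) ∧ L.sum = n ∧ s = (L.map f).sum}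

/-- A combinatorial path in the Cayley graph `Γ(G, X ∪ 𝓗)`: a starting vertex
together with the word labelling the path. -/
structure RelPath (H : Λ → Subgroup G) (X : Set G) where
  start : G
  word : List (RelLetter H X)

namespace RelPath

variable {H : Λ → Subgroup G} {X : Set G}

/-- The length of the path. -/
def len (p : RelPath H X) : ℕ := p.word.length

/-- The `k`-th vertex of the path. -/
def vertex (p : RelPath H X) (k : ℕ) : G :=
  p.start * ((p.word.take k).map RelLetter.val).prod

/-- The terminal vertex of the path. -/
def finish (p : RelPath H X) : G := p.vertex p.word.length

end RelPath

/-- The combinatorial metric `dist_{X ∪ 𝓗}` on `G`. -/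
noncomputable def relDist (H : Λ → Subgroup G) (X : Set G) (g h : G) : ℕ :=
  wordLength (X ∪ ⋃ l, (H l : Set G)) (g⁻¹ * h)

/-- The relative length `|g|_{X ∪ 𝓗}`. -/
noncomputable def relLen (H : Λ → Subgroup G) (X : Set G) (g : G) : ℕ :=
  wordLength (X ∪ ⋃ l, (H l : Set G)) g

/-- The word metric `dist_X` on `G`. -/
noncomputable def xDist (X : Set G) (g h : G) : ℕ := wordLength X (g⁻¹ * h)

variable {H : Λ → Subgroup G} {X : Set G}

/-- `p` is a `(λ, c)`-quasi-geodesic in `Γ(G, X ∪ 𝓗)`. -/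
def IsQuasiGeodesic (lam c : ℝ) (p : RelPath H X) : Prop :=
  ∀ i j : ℕ, i ≤ j → j ≤ p.len →
    ((j - i : ℕ) : ℝ) ≤ lam * (relDist H X (p.vertex i) (p.vertex j) : ℝ) + c

/-- `p` is a geodesic in `Γ(G, X ∪ 𝓗)`. -/
def IsGeodesic (p : RelPath H X) : Prop :=
  ∀ i j : ℕ, i ≤ j → j ≤ p.len → j - i = relDist H X (p.vertex i) (p.vertex j)

/-- The `k`-th letter of `p` is a letter of `H̃_l`. -/
def LetterIsH (p : RelPath H X) (l : Λ) (k : ℕ) : Prop :=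
  ∃ a, p.word[k]? = some a ∧ a.hIndex = some l

/-- The subpath of `p` consisting of the letters with indices `a, …, b` is an
`H_l`-component of `p` (a maximal nonempty `H_l`-subword). -/
def IsComponent (p : RelPath H X) (l : Λ) (a b : ℕ) : Prop :=
  a ≤ b ∧ b < p.len ∧ (∀ k, a ≤ k → k ≤ b → LetterIsH p l k) ∧
    (a = 0 ∨ ¬ LetterIsH p l (a - 1)) ∧ (b + 1 = p.len ∨ ¬ LetterIsH p l (b + 1))

/-- The `H_l`-components of `p` starting at index `a` and of `q` starting at `a'`
are connected (their vertices lie in the same left coset of `H_l`). -/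
def ConnectedComp (p q : RelPath H X) (l : Λ) (a a' : ℕ) : Prop :=
  (p.vertex a)⁻¹ * q.vertex a' ∈ H l

/-- `p` is a path without backtracking: all of its components are isolated. -/
def NoBacktracking (p : RelPath H X) : Prop :=
  ∀ l a b a' b', IsComponent p l a b → IsComponent p l a' b' →
    ConnectedComp p p l a a' → a = a' ∧ b = b'

/-- The `k`-th vertex of `p` is a phase vertex (not an inner vertex of a component). -/
def IsPhase (p : RelPath H X) (k : ℕ) : Prop :=
  ¬ ∃ l a b, IsComponent p l a b ∧ a < k ∧ k ≤ b

/-- `p` and `q` are `k`-similar: their endpoints are `X`-distance at most `k` apart. -/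
def Similar (k : ℝ) (p q : RelPath H X) : Prop :=
  (xDist X p.start q.start : ℝ) ≤ k ∧ (xDist X p.finish q.finish : ℝ) ≤ k

/-- The Rips thin-triangles condition for `Γ(G, X ∪ 𝓗)` with constant `δ`. -/
def RipsThin (H : Λ → Subgroup G) (X : Set G) (δ : ℝ) : Prop :=
  ∀ p q r : RelPath H X, IsGeodesic p → IsGeodesic q → IsGeodesic r →
    p.finish = q.start → q.finish = r.start → r.finish = p.start →
    ∀ i ≤ p.len, ∃ j : ℕ,
      (j ≤ q.len ∧ (relDist H X (p.vertex i) (q.vertex j) : ℝ) ≤ δ) ∨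
      (j ≤ r.len ∧ (relDist H X (p.vertex i) (r.vertex j) : ℝ) ≤ δ)

/-- The Cayley graph `Γ(G, X ∪ 𝓗)` is a hyperbolic metric space. -/
def CayleyHyperbolic (H : Λ → Subgroup G) (X : Set G) : Prop :=
  ∃ δ : ℝ, 0 ≤ δ ∧ RipsThin H X δ

/-- `R` is a relatively quasi-convex subgroup of `G`. -/
def RelQuasiconvex (H : Λ → Subgroup G) (X : Set G) (R : Subgroup G) : Prop :=
  ∃ σ : ℝ, 0 < σ ∧ ∀ p : RelPath H X, IsGeodesic p → p.start ∈ R → p.finish ∈ R →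
    ∀ k ≤ p.len, ∃ w ∈ R, (xDist X (p.vertex k) w : ℝ) ≤ σ

/-- `R` is a strongly relatively quasi-convex subgroup of `G`. -/
def StronglyRelQuasiconvex (H : Λ → Subgroup G) (X : Set G) (R : Subgroup G) : Prop :=
  RelQuasiconvex H X R ∧ ∀ (g : G) (l : Λ), {x : G | x ∈ R ∧ g * x * g⁻¹ ∈ H l}.Finite

/-- `g` is a hyperbolic element: it is not conjugate to an element of any `H_λ`. -/
def IsHypElt (H : Λ → Subgroup G) (g : G) : Prop :=
  ∀ l : Λ, ∀ x ∈ H l, ¬ IsConj g x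

end RelHyp

open RelHyp

namespace RelHyp

section GraphMetric

variable {V : Type*}

/-- `d` is the path metric on the vertex set of a connected graph. -/
structure IsGraphMetric (d : V → V → ℕ) : Prop where
  self : ∀ x, d x x = 0
  eq_of_zero : ∀ x y, d x y = 0 → x = y
  symm : ∀ x y, d x y = d y x
  tri : ∀ x y z, d x z ≤ d x y + d y z
  step : ∀ x y n, d x y = n + 1 → ∃ z, d x z ≤ 1 ∧ d z y = n

/-- `a` restricted to `{0, …, n}` is a geodesic. -/
def IsGeod (d : V → V → ℕ) (a : ℕ → V) (n : ℕ) : Prop :=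
  ∀ i j, i ≤ j → j ≤ n → d (a i) (a j) = j - i

/-- There is an edge path of length `n` from `x` to `y` along which the
Riemann sum of `f dg` equals `s`. -/
inductive PathIntegral (d : V → V → ℕ) (f g : V → ℝ) : ℕ → V → V → ℝ → Prop
  | nil (x : V) : PathIntegral d f g 0 x x 0
  | cons {n : ℕ} {x y z : V} {s : ℝ} : d x y ≤ 1 → PathIntegral d f g n y z s →
      PathIntegral d f g (n + 1) x z (f x * (g y - g x) + s)

theorem PathIntegral.trans {d : V → V → ℕ} {f g : V → ℝ} {n m : ℕ} {x y z : V} {s t : ℝ}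
    (h : PathIntegral d f g n x y s) (h' : PathIntegral d f g m y z t) :
    PathIntegral d f g (n + m) x z (s + t) := by
  induction h with
  | nil x => simpa using h'
  | @cons n x y w s hd _ ih =>
    have := PathIntegral.cons hd (ih h')
    rw [show n + 1 + m = n + m + 1 by ring, add_assoc (f x * (g y - g x))]
    exact this

/-- There is an edge path of length at most `n` from `x` to `y` with all its vertices in `S`. -/
inductive JoinedWithin (d : V → V → ℕ) (S : Set V) : ℕ → V → V → Prop
  | nil {n : ℕ} {x : V} : x ∈ S → JoinedWithin d S n x x
  | cons {n : ℕ} {x y z : V} : x ∈ S → d x y ≤ 1 → JoinedWithin d S n y z →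
      JoinedWithin d S (n + 1) x z

namespace JoinedWithin

variable {d : V → V → ℕ} {S : Set V}

theorem mono {n m : ℕ} {x y : V} (h : JoinedWithin d S n x y) (hnm : n ≤ m) :
    JoinedWithin d S m x y := by
  induction h generalizing m with
  | nil hx => exact .nil hx
  | cons hx hd _ ih =>
    obtain ⟨k, rfl⟩ : ∃ k, m = k + 1 := ⟨m - 1, by omega⟩
    exact .cons hx hd (ih (by omega))

theorem mono_set {T : Set V} (hST : S ⊆ T) {n : ℕ} {x y : V} (h : JoinedWithin d S n x y) :
    JoinedWithin d T n x y := by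
  induction h with
  | nil hx => exact .nil (hST hx)
  | cons hx hd _ ih => exact .cons (hST hx) hd ih

theorem trans {n m : ℕ} {x y z : V} (h : JoinedWithin d S n x y) (h' : JoinedWithin d S m y z) :
    JoinedWithin d S (n + m) x z := by
  induction h with
  | nil hx => exact h'.mono (by omega)
  | cons hx hd _ ih => exact ((ih h').cons hx hd).mono (by omega)

theorem left_mem {n : ℕ} {x y : V} (h : JoinedWithin d S n x y) : x ∈ S := by
  cases h <;> assumption

theorem right_mem {n : ℕ} {x y : V} (h : JoinedWithin d S n x y) : y ∈ S := by
  induction h <;> assumption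

theorem symm (hd : IsGraphMetric d) {n : ℕ} {x y : V} (h : JoinedWithin d S n x y) :
    JoinedWithin d S n y x := by
  induction h with
  | nil hx => exact .nil hx
  | cons hx hd' h ih =>
    exact ih.trans (.cons h.left_mem (by rwa [hd.symm]) (.nil (n := 0) hx))

theorem dist_le (hd : IsGraphMetric d) {n : ℕ} {x y : V} (h : JoinedWithin d S n x y) :
    d x y ≤ n := by
  induction h with
  | nil hx => simp [hd.self]
  | @cons n x y z hx hd' h ih => have := hd.tri x y z; omega

theorem pathIntegral {f g : V → ℝ} (hf : ∀ x ∈ S, f x = 0) {n : ℕ} {x y : V}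
    (h : JoinedWithin d S n x y) : ∃ m ≤ n, PathIntegral d f g m x y 0 := by
  induction h with
  | nil hx => exact ⟨0, by omega, .nil _⟩
  | @cons n x y z hx hd' h ih =>
    obtain ⟨m, hm, hp⟩ := ih
    exact ⟨m + 1, by omega, by simpa [hf x hx] using hp.cons hd'⟩

theorem of_segment (hd : IsGraphMetric d) {a : ℕ → V} {n : ℕ} (ha : IsGeod d a n)
    (hS : ∀ i ≤ n, a i ∈ S) {i j k : ℕ} (hi : i ≤ n) (hj : j ≤ n) (hk : d (a i) (a j) ≤ k) :
    JoinedWithin d S k (a i) (a j) := by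
  have key : ∀ m i, i + m ≤ n → JoinedWithin d S m (a i) (a (i + m)) := by
    intro m
    induction m with
    | zero => intro i hi; exact .nil (hS _ hi)
    | succ m ih =>
      intro i hi
      have := ih (i + 1) (by omega)
      rw [show i + 1 + m = i + (m + 1) by ring] at this
      refine .cons (hS _ (by omega)) ?_ this
      rw [ha i (i + 1) (by omega) (by omega)]; omega
  rcases le_total i j with h | h
  · have h1 := ha i j h hj
    have := key (j - i) i (by omega)
    rw [show i + (j - i) = j by omega] at this
    exact this.mono (by omega)
  · have h1 := ha j i h hi
    have := key (i - j) j (by omega)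
    rw [show j + (i - j) = i by omega] at this
    rw [hd.symm] at h1
    exact (this.symm hd).mono (by omega)

theorem of_far (hd : IsGraphMetric d) {p x y : V} {N : ℕ} (hxy : d x y ≤ N)
    (hx : 2 * N ≤ d x p) : JoinedWithin d {z | N ≤ d z p} N x y := by
  have key : ∀ m x, d x y = m → N + m ≤ d x p → JoinedWithin d {z | N ≤ d z p} m x y := by
    intro m
    induction m with
    | zero =>
      intro x hxy hx
      obtain rfl := hd.eq_of_zero x y hxy
      exact .nil (by simpa using hx)
    | succ m ih =>
      intro x hxy hx
      obtain ⟨z, hz, hzy⟩ := hd.step x y m hxy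
      have := hd.tri x z p
      exact .cons (by simp; omega) hz (ih z hzy (by omega))
  exact (key _ x rfl (by omega)).mono hxy

end JoinedWithin

/-- The Riemann sums of Lipschitz `1`-forms over closed paths grow at most linearly. -/
def LinearStokes (d : V → V → ℕ) (C : ℝ) : Prop :=
  ∀ f g : V → ℝ, (∀ x y, |f x - f y| ≤ d x y) → (∀ x y, |g x - g y| ≤ d x y) →
    ∀ n x s, PathIntegral d f g n x x s → |s| ≤ C * (n + 1)

theorem IsGeod.pathIntegral {d : V → V → ℕ} {a : ℕ → V} {n : ℕ} (ha : IsGeod d a n)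
    (f g : V → ℝ) (i : ℕ) (hg : ∀ j, i ≤ j → j ≤ n → g (a j) = (j : ℝ) - i) (k : ℕ)
    (hk : i + k ≤ n) :
    PathIntegral d f g k (a i) (a (i + k)) (∑ j ∈ Finset.range k, f (a (i + j))) := by
  induction k with
  | zero => simpa using PathIntegral.nil (a i)
  | succ k ih =>
    have h1 : d (a (i + k)) (a (i + (k + 1))) ≤ 1 := by
      rw [ha _ _ (by omega) hk]; omega
    have h2 := (ih (by omega)).trans (.cons h1 (.nil (f := f) (g := g) _))
    rw [hg (i + k) (by omega) (by omega), hg (i + (k + 1)) (by omega) hk] at h2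
    rw [Finset.sum_range_succ]
    convert h2 using 1
    push_cast; ring

theorem IsGraphMetric.abs_sub_le {d : V → V → ℕ} (hd : IsGraphMetric d) (x y p : V) :
    |(d x p : ℝ) - d y p| ≤ d x y := by
  have h1 : (d x p : ℝ) ≤ d x y + d y p := by exact_mod_cast hd.tri x y p
  have h2 : (d y p : ℝ) ≤ d x y + d x p := by
    rw [hd.symm x y]; exact_mod_cast hd.tri y x p
  rw [abs_le]; constructor <;> linarith

/-- If a geodesic segment can be bypassed by a path of length at most `K` avoiding
the ball of radius `N` about a point of the segment, then `N ^ 2` is at most linear in `K`. -/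
theorem LinearStokes.sq_le_of_bypass {d : V → V → ℕ} {C : ℝ} (hd : IsGraphMetric d)
    (hS : LinearStokes d C) {a : ℕ → V} {n : ℕ} (ha : IsGeod d a n) {i i₁ i₂ m K : ℕ}
    (h1 : i₁ ≤ i) (h2 : i ≤ i₂) (h3 : i₂ ≤ n)
    (hK : JoinedWithin d {z | 2 * m ≤ d z (a i)} K (a i₁) (a i₂)) :
    (m : ℝ) ^ 2 ≤ |C| * (2 * K + 1) := by
  set f : V → ℝ := fun x => max 0 (2 * (m : ℝ) - d x (a i)) with hf
  set g : V → ℝ := fun x => d x (a i₁) with hg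
  have hflip : ∀ x y, |f x - f y| ≤ d x y := by
    intro x y
    refine (abs_max_sub_max_le_max _ _ _ _).trans ?_
    rw [sub_self, abs_zero, max_eq_right (abs_nonneg _)]
    rw [sub_sub_sub_cancel_left, abs_sub_comm]
    exact hd.abs_sub_le x y (a i)
  have hglip : ∀ x y, |g x - g y| ≤ d x y := fun x y => hd.abs_sub_le x y _
  have hga : ∀ j, i₁ ≤ j → j ≤ n → g (a j) = (j : ℝ) - i₁ := by
    intro j hj hjn
    simp only [hg]
    rw [hd.symm, ha _ _ hj hjn, Nat.cast_sub hj]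
  have hI := ha.pathIntegral f g i₁ hga (i₂ - i₁) (by omega)
  rw [show i₁ + (i₂ - i₁) = i₂ by omega] at hI
  have hfS : ∀ x ∈ {z | 2 * m ≤ d z (a i)}, f x = 0 := by
    intro x hx
    have : (2 * m : ℝ) ≤ d x (a i) := by exact_mod_cast hx
    simp only [hf]
    exact max_eq_left (by linarith)
  obtain ⟨k, hk, hJ⟩ := (hK.symm hd).pathIntegral (g := g) hfS
  have hle := hS f g hflip hglip _ _ _ (hI.trans hJ)
  have hlen : i₂ - i₁ ≤ K := by
    rw [← ha i₁ i₂ (by omega) h3]; exact hK.dist_le hd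
  have hr : i + 2 * m ≤ i₂ := by
    have := hK.right_mem
    simp only [Set.mem_ofPred_eq] at this
    rw [hd.symm, ha i i₂ h2 h3] at this
    omega
  have hsum : (m : ℝ) ^ 2 ≤ ∑ j ∈ Finset.range (i₂ - i₁), f (a (i₁ + j)) := by
    have hsub : Finset.Ico (i - i₁) (i - i₁ + m) ⊆ Finset.range (i₂ - i₁) := by
      intro j hj
      simp only [Finset.mem_Ico, Finset.mem_range] at *
      omega
    refine le_trans ?_ (Finset.sum_le_sum_of_subset_of_nonneg hsub
      fun j _ _ => le_max_left _ _)
    have : ∀ j ∈ Finset.Ico (i - i₁) (i - i₁ + m), (m : ℝ) ≤ f (a (i₁ + j)) := by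
      intro j hj
      simp only [Finset.mem_Ico] at hj
      refine le_trans ?_ (le_max_right _ _)
      rw [hd.symm, ha _ _ (by omega) (by omega)]
      have : ((i₁ + j - i : ℕ) : ℝ) ≤ m := by exact_mod_cast (by omega : i₁ + j - i ≤ m)
      linarith
    have := Finset.card_nsmul_le_sum _ _ _ this
    simp only [Nat.card_Ico, add_tsub_cancel_left, nsmul_eq_mul] at this
    rw [sq]; exact this
  have h5 := le_abs_self (∑ j ∈ Finset.range (i₂ - i₁), f (a (i₁ + j)) + 0)
  have h6 : (((i₂ - i₁ + k : ℕ) : ℝ) + 1) ≤ 2 * K + 1 := by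
    have : i₂ - i₁ + k ≤ 2 * K := by omega
    have : ((i₂ - i₁ + k : ℕ) : ℝ) ≤ ((2 * K : ℕ) : ℝ) := by exact_mod_cast this
    push_cast at this ⊢; linarith
  have h7 : C * (((i₂ - i₁ + k : ℕ) : ℝ) + 1) ≤ |C| * (2 * K + 1) :=
    mul_le_mul (le_abs_self C) h6 (by positivity) (abs_nonneg C)
  linarith

/-- The side `a` lies in the `N`-neighbourhood of the sides `b` and `c`. -/
def SideThin (d : V → V → ℕ) (N : ℕ) (a : ℕ → V) (la : ℕ) (b : ℕ → V) (lb : ℕ)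
    (c : ℕ → V) (lc : ℕ) : Prop :=
  ∀ i ≤ la, (∃ j ≤ lb, d (a i) (b j) ≤ N) ∨ ∃ j ≤ lc, d (a i) (c j) ≤ N

theorem exists_bypass {d : V → V → ℕ} (hd : IsGraphMetric d) {a b c : ℕ → V} {la lb lc N i : ℕ}
    (ha : IsGeod d a la) (hb : IsGeod d b lb) (hc : IsGeod d c lc)
    (hab : a la = b 0) (hbc : b lb = c 0) (hca : c lc = a 0)
    (hTa : SideThin d N a la b lb c lc) (hTb : SideThin d N b lb c lc a la)
    (hTc : SideThin d N c lc a la b lb) (hi : i ≤ la)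
    (hfb : ∀ j ≤ lb, N ≤ d (b j) (a i)) (hfc : ∀ j ≤ lc, N ≤ d (c j) (a i)) :
    ∃ i₁ ≤ i, ∃ i₂, i ≤ i₂ ∧ i₂ ≤ la ∧
      JoinedWithin d {z | N ≤ d z (a i)} (20 * N) (a i₁) (a i₂) := by
  set S := {z | N ≤ d z (a i)} with hSdef
  have segb : ∀ {j j' k : ℕ}, j ≤ lb → j' ≤ lb → d (b j) (b j') ≤ k →
      JoinedWithin d S k (b j) (b j') := fun hj hj' hk => .of_segment hd hb hfb hj hj' hk
  have segc : ∀ {j j' k : ℕ}, j ≤ lc → j' ≤ lc → d (c j) (c j') ≤ k →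
      JoinedWithin d S k (c j) (c j') := fun hj hj' hk => .of_segment hd hc hfc hj hj' hk
  have left : ∃ i₁ ≤ i, i ≤ i₁ + 2 * N ∧ ((∃ j ≤ lc, JoinedWithin d S N (a i₁) (c j)) ∨
      ∃ j ≤ lb, JoinedWithin d S N (a i₁) (b j)) := by
    rcases lt_or_ge i (2 * N) with h | h
    · refine ⟨0, by omega, by omega, .inl ⟨lc, le_rfl, ?_⟩⟩
      rw [← hca]; exact .nil (hfc _ le_rfl)
    · have hfar : 2 * N ≤ d (a (i - 2 * N)) (a i) := by
        rw [ha _ _ (by omega) hi]; omega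
      refine ⟨i - 2 * N, by omega, by omega, ?_⟩
      rcases hTa (i - 2 * N) (by omega) with ⟨j, hj, h⟩ | ⟨j, hj, h⟩
      · exact .inr ⟨j, hj, .of_far hd h hfar⟩
      · exact .inl ⟨j, hj, .of_far hd h hfar⟩
  have right : ∃ i₂, i ≤ i₂ ∧ i₂ ≤ la ∧ i₂ ≤ i + 2 * N ∧
      ((∃ j ≤ lc, JoinedWithin d S N (a i₂) (c j)) ∨
      ∃ j ≤ lb, JoinedWithin d S N (a i₂) (b j)) := by
    rcases lt_or_ge la (i + 2 * N) with h | h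
    · refine ⟨la, by omega, by omega, by omega, .inr ⟨0, by omega, ?_⟩⟩
      rw [hab]; exact .nil (hfb _ (by omega))
    · have hfar : 2 * N ≤ d (a (i + 2 * N)) (a i) := by
        rw [hd.symm, ha _ _ (by omega) (by omega)]; omega
      refine ⟨i + 2 * N, by omega, by omega, by omega, ?_⟩
      rcases hTa (i + 2 * N) (by omega) with ⟨j, hj, h⟩ | ⟨j, hj, h⟩
      · exact .inr ⟨j, hj, .of_far hd h hfar⟩
      · exact .inl ⟨j, hj, .of_far hd h hfar⟩
  obtain ⟨i₁, hi₁, hi₁', hleft⟩ := left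
  obtain ⟨i₂, hi₂, hi₂l, hi₂', hright⟩ := right
  have hmid : d (a i₁) (a i₂) ≤ 4 * N := by rw [ha _ _ (by omega) hi₂l]; omega
  have hia : d (a i₁) (a i) ≤ 2 * N := by rw [ha _ _ hi₁ hi]; omega
  have feet : ∀ {x y : V}, JoinedWithin d S N (a i₁) x → JoinedWithin d S N (a i₂) y →
      d x y ≤ 6 * N := by
    intro x y hx hy
    have h1 := hx.dist_le hd
    have h2 := hy.dist_le hd
    have h3 := hd.tri x (a i₁) y
    have h4 := hd.tri (a i₁) (a i₂) y
    rw [hd.symm x (a i₁)] at h3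
    omega
  rcases hleft with ⟨j, hj, hL⟩ | ⟨j, hj, hL⟩ <;> rcases hright with ⟨j', hj', hR⟩ | ⟨j', hj', hR⟩
  · exact ⟨i₁, hi₁, i₂, hi₂, hi₂l,
      ((hL.trans (segc hj hj' (feet hL hR))).trans (hR.symm hd)).mono (by omega)⟩
  · have hjj' := feet hL hR
    have hL1 := hL.dist_le hd
    rcases lt_or_ge j (5 * N) with h | h
    · have h0 : d (c j) (c 0) = j := by rw [hd.symm, hc 0 j (by omega) hj]; omega
      have h1 : d (b lb) (b j') ≤ 11 * N := by
        have := hd.tri (c 0) (c j) (b j')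
        rw [hbc]; rw [hd.symm] at h0; omega
      have h2 := segc hj (Nat.zero_le _) h0.le
      rw [← hbc] at h2
      exact ⟨i₁, hi₁, i₂, hi₂, hi₂l,
        (((hL.trans h2).trans (segb le_rfl hj' h1)).trans (hR.symm hd)).mono (by omega)⟩
    · have h0 : d (c j) (c (j - 5 * N)) = 5 * N := by
        rw [hd.symm, hc _ j (by omega) hj]; omega
      have hseg := segc hj (by omega) h0.le
      have hfar : 2 * N ≤ d (c (j - 5 * N)) (a i) := by
        have h1 := hd.tri (c j) (c (j - 5 * N)) (a i₁)
        have h2 := hd.tri (c j) (c (j - 5 * N)) (a i)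
        have h3 := hd.tri (c (j - 5 * N)) (a i) (a i₁)
        have h4 := hd.tri (c j) (a i₁) (c (j - 5 * N))
        have h5 := hd.tri (a i₁) (a i) (c (j - 5 * N))
        rw [hd.symm (c j) (a i₁)] at h4
        rw [hd.symm (a i) (c _)] at h5
        omega
      rcases hTc (j - 5 * N) (by omega) with ⟨k, hk, hd'⟩ | ⟨k, hk, hd'⟩
      · have hik : i ≤ k := by
          have h1 := hc (j - 5 * N) lc (by omega) le_rfl
          have h2 := hc j lc hj le_rfl
          have h3 := ha 0 k (by omega) hk
          have h4 := ha 0 i₁ (by omega) (by omega)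
          have h5 := hd.tri (c (j - 5 * N)) (a k) (a 0)
          have h6 := hd.tri (a i₁) (c j) (a 0)
          rw [hca] at h1 h2
          rw [hd.symm] at h3 h4
          omega
        exact ⟨i₁, hi₁, k, hik, hk, ((hL.trans hseg).trans (.of_far hd hd' hfar)).mono (by omega)⟩
      · have h1 : d (b k) (b j') ≤ 12 * N := by
          have h1 := hd.tri (b k) (c (j - 5 * N)) (b j')
          have h2 := hd.tri (c (j - 5 * N)) (c j) (b j')
          rw [hd.symm (b k) (c (j - 5 * N))] at h1
          rw [hd.symm (c _) (c j)] at h2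
          omega
        exact ⟨i₁, hi₁, i₂, hi₂, hi₂l, ((((hL.trans hseg).trans (.of_far hd hd' hfar)).trans
          (segb hk hj' h1)).trans (hR.symm hd)).mono (by omega)⟩
  · have hjj' := feet hL hR
    have hL1 := hL.dist_le hd
    rcases lt_or_ge j (5 * N) with h | h
    · have h0 : d (b j) (b 0) = j := by rw [hd.symm, hb 0 j (by omega) hj]; omega
      have h2 := segb hj (Nat.zero_le _) h0.le
      rw [← hab] at h2
      exact ⟨i₁, hi₁, la, hi, le_rfl, (hL.trans h2).mono (by omega)⟩
    · have h0 : d (b j) (b (j - 5 * N)) = 5 * N := by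
        rw [hd.symm, hb _ j (by omega) hj]; omega
      have hseg := segb hj (by omega) h0.le
      have hfar : 2 * N ≤ d (b (j - 5 * N)) (a i) := by
        have h4 := hd.tri (b j) (a i₁) (b (j - 5 * N))
        have h5 := hd.tri (a i₁) (a i) (b (j - 5 * N))
        rw [hd.symm (b j) (a i₁)] at h4
        rw [hd.symm (a i) (b _)] at h5
        omega
      rcases hTb (j - 5 * N) (by omega) with ⟨k, hk, hd'⟩ | ⟨k, hk, hd'⟩
      · have h1 : d (c k) (c j') ≤ 12 * N := by
          have h1 := hd.tri (c k) (b (j - 5 * N)) (c j')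
          have h2 := hd.tri (b (j - 5 * N)) (b j) (c j')
          rw [hd.symm (c k) (b (j - 5 * N))] at h1
          rw [hd.symm (b _) (b j)] at h2
          omega
        exact ⟨i₁, hi₁, i₂, hi₂, hi₂l, ((((hL.trans hseg).trans (.of_far hd hd' hfar)).trans
          (segc hk hj' h1)).trans (hR.symm hd)).mono (by omega)⟩
      · have hik : i ≤ k := by
          have h1 := hb 0 (j - 5 * N) (by omega) (by omega)
          have h2 := hb 0 j (by omega) hj
          have h3 := ha k la hk le_rfl
          have h4 := ha i₁ la (by omega) le_rfl
          have h5 := hd.tri (a k) (b (j - 5 * N)) (a la)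
          have h6 := hd.tri (b j) (a i₁) (a la)
          rw [hab] at h3 h4 h5 h6
          rw [hd.symm (a k) (b (j - 5 * N)), hd.symm (b (j - 5 * N)) (b 0)] at h5
          rw [hd.symm (b j) (b 0), hd.symm (b j) (a i₁)] at h6
          omega
        exact ⟨i₁, hi₁, k, hik, hk, ((hL.trans hseg).trans (.of_far hd hd' hfar)).mono (by omega)⟩
  · exact ⟨i₁, hi₁, i₂, hi₂, hi₂l,
      ((hL.trans (segb hj hj' (feet hL hR))).trans (hR.symm hd)).mono (by omega)⟩

/-- A linear bound on Riemann sums of Lipschitz `1`-forms forces geodesic triangles to be thin. -/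
theorem LinearStokes.exists_thin {d : V → V → ℕ} {C : ℝ} (hd : IsGraphMetric d)
    (hS : LinearStokes d C) : ∃ D : ℕ, ∀ (a b c : ℕ → V) (la lb lc : ℕ),
      IsGeod d a la → IsGeod d b lb → IsGeod d c lc →
      a la = b 0 → b lb = c 0 → c lc = a 0 → SideThin d D a la b lb c lc := by
  obtain ⟨M, hM⟩ := exists_nat_gt (241 * |C| + 1)
  have hM1 : (1 : ℝ) < M := by have := abs_nonneg C; linarith
  have step : ∀ (N : ℕ) (a b c : ℕ → V) (la lb lc : ℕ),
      IsGeod d a la → IsGeod d b lb → IsGeod d c lc →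
      a la = b 0 → b lb = c 0 → c lc = a 0 → 2 * M ≤ N → SideThin d (N + 1) a la b lb c lc →
      SideThin d (N + 1) b lb c lc a la → SideThin d (N + 1) c lc a la b lb →
      SideThin d N a la b lb c lc := by
    intro N a b c la lb lc ha hb hc hab hbc hca hN hTa hTb hTc i hi
    by_contra! hcon
    obtain ⟨i₁, h1, i₂, h2, h3, hJ⟩ := exists_bypass hd ha hb hc hab hbc hca hTa hTb hTc hi
      (fun j hj => by rw [hd.symm]; exact hcon.1 j hj)
      (fun j hj => by rw [hd.symm]; exact hcon.2 j hj)
    obtain ⟨m, hm, hm'⟩ : ∃ m, 2 * m ≤ N + 1 ∧ N ≤ 2 * m := ⟨(N + 1) / 2, by omega, by omega⟩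
    have hJ' : JoinedWithin d {z | 2 * m ≤ d z (a i)} (20 * (N + 1)) (a i₁) (a i₂) :=
      hJ.mono_set fun z hz => hm.trans hz
    have hle := hS.sq_le_of_bypass hd ha h1 h2 h3 hJ'
    have hMm : (M : ℝ) ≤ m := by exact_mod_cast (by omega : M ≤ m)
    have hNm : (N : ℝ) ≤ 2 * m := by exact_mod_cast hm'
    push_cast at hle
    have hb : |C| * (2 * (20 * ((N : ℝ) + 1)) + 1) ≤ |C| * (241 * m) :=
      mul_le_mul_of_nonneg_left (by linarith) (abs_nonneg C)
    nlinarith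
  refine ⟨2 * M, fun a b c la lb lc ha hb hc hab hbc hca => ?_⟩
  have desc : ∀ k, SideThin d (2 * M + k) a la b lb c lc ∧ SideThin d (2 * M + k) b lb c lc a la ∧
      SideThin d (2 * M + k) c lc a la b lb → SideThin d (2 * M) a la b lb c lc := by
    intro k
    induction k with
    | zero => exact fun h => h.1
    | succ k ih =>
      rintro ⟨h1, h2, h3⟩
      exact ih ⟨step _ _ _ _ _ _ _ ha hb hc hab hbc hca (by omega) h1 h2 h3,
        step _ _ _ _ _ _ _ hb hc ha hbc hca hab (by omega) h2 h3 h1,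
        step _ _ _ _ _ _ _ hc ha hb hca hab hbc (by omega) h3 h1 h2⟩
  have start : ∀ {a b c : ℕ → V} {la lb lc N : ℕ}, IsGeod d a la → c lc = a 0 → la ≤ N →
      SideThin d N a la b lb c lc := by
    intro a b c la lb lc N ha hca hN i hi
    refine .inr ⟨lc, le_rfl, ?_⟩
    rw [hca, hd.symm, ha 0 i (by omega) hi]; omega
  exact desc (la + lb + lc) ⟨start ha hca (by omega), start hb hab (by omega),
    start hc hbc (by omega)⟩

end GraphMetric

section Words

variable {G : Type*} [Group G] {Λ : Type*} {H : Λ → Subgroup G} {X : Set G}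

/-- The element of `G` represented by a word over `X ∪ 𝓗`. -/
def wordVal (w : List (RelLetter H X)) : G := (w.map RelLetter.val).prod

@[simp] theorem wordVal_nil : wordVal ([] : List (RelLetter H X)) = 1 := rfl

@[simp] theorem wordVal_cons (a : RelLetter H X) (w : List (RelLetter H X)) :
    wordVal (a :: w) = a.val * wordVal w := by simp [wordVal]

@[simp] theorem wordVal_append (v w : List (RelLetter H X)) :
    wordVal (v ++ w) = wordVal v * wordVal w := by simp [wordVal]

@[simp] theorem wordToF_nil : wordToF ([] : List (RelLetter H X)) = 1 := rfl

@[simp] theorem wordToF_cons (a : RelLetter H X) (w : List (RelLetter H X)) :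
    wordToF (a :: w) = a.toF * wordToF w := by simp [wordToF]

@[simp] theorem wordToF_append (v w : List (RelLetter H X)) :
    wordToF (v ++ w) = wordToF v * wordToF w := by simp [wordToF]

theorem RelLetter.relEps_toF (a : RelLetter H X) : relEps H X a.toF = a.val := by
  rcases a with ⟨l, h⟩ | ⟨x, b⟩
  · simp [relEps, RelLetter.toF, RelLetter.val]
  · cases b <;> simp [relEps, RelLetter.toF, RelLetter.val]

theorem relEps_wordToF (w : List (RelLetter H X)) : relEps H X (wordToF w) = wordVal w := by
  induction w with
  | nil => simp
  | cons a w ih => simp [ih, RelLetter.relEps_toF]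

theorem RelLetter.exists_inv (a : RelLetter H X) :
    ∃ b : RelLetter H X, b.toF = a.toF⁻¹ := by
  rcases a with ⟨l, h⟩ | ⟨x, b⟩
  · exact ⟨.inl ⟨l, ⟨h.1⁻¹, inv_ne_one.2 h.2⟩⟩, by simp [RelLetter.toF]⟩
  · refine ⟨.inr (x, !b), ?_⟩
    cases b <;> simp [RelLetter.toF]

theorem exists_inv_word (w : List (RelLetter H X)) :
    ∃ v : List (RelLetter H X), v.length = w.length ∧ wordToF v = (wordToF w)⁻¹ := by
  induction w with
  | nil => exact ⟨[], rfl, by simp⟩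
  | cons a w ih =>
    obtain ⟨v, hv, hv'⟩ := ih
    obtain ⟨b, hb⟩ := a.exists_inv
    exact ⟨v ++ [b], by simp [hv], by simp [hv', hb]⟩

theorem exists_word (u : RelFree H X) : ∃ w : List (RelLetter H X), wordToF w = u := by
  induction u using Monoid.Coprod.induction_on with
  | inl m =>
    induction m using Monoid.CoprodI.induction_on with
    | one => exact ⟨[], by simp⟩
    | of l h =>
      by_cases h1 : h = 1
      · exact ⟨[], by simp [h1]⟩
      · exact ⟨[.inl ⟨l, ⟨h, h1⟩⟩], by simp [RelLetter.toF]⟩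
    | mul x y hx hy =>
      obtain ⟨v, hv⟩ := hx
      obtain ⟨w, hw⟩ := hy
      exact ⟨v ++ w, by simp [hv, hw]⟩
  | inr n =>
    induction n using FreeGroup.induction_on with
    | C1 => exact ⟨[], by simp⟩
    | of x => exact ⟨[.inr (x, true)], by simp [RelLetter.toF]⟩
    | inv_of x _ => exact ⟨[.inr (x, false)], by simp [RelLetter.toF]⟩
    | mul x y hx hy =>
      obtain ⟨v, hv⟩ := hx
      obtain ⟨w, hw⟩ := hy
      exact ⟨v ++ w, by simp [hv, hw]⟩
  | mul x y hx hy =>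
    obtain ⟨v, hv⟩ := hx
    obtain ⟨w, hw⟩ := hy
    exact ⟨v ++ w, by simp [hv, hw]⟩

theorem exists_wordVal_eq (hsurj : Function.Surjective (relEps H X)) (g : G) :
    ∃ w : List (RelLetter H X), wordVal w = g := by
  obtain ⟨u, hu⟩ := hsurj g
  obtain ⟨w, rfl⟩ := exists_word u
  exact ⟨w, by rw [← relEps_wordToF, hu]⟩

theorem RelLetter.val_mem (a : RelLetter H X) :
    a.val ∈ (X ∪ ⋃ l, (H l : Set G)) ∨ a.val⁻¹ ∈ (X ∪ ⋃ l, (H l : Set G)) := by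
  rcases a with ⟨l, h⟩ | ⟨x, b⟩
  · exact .inl (.inr (Set.mem_iUnion.2 ⟨l, h.1.2⟩))
  · cases b
    · exact .inr (.inl (by simp [RelLetter.val]))
    · exact .inl (.inl (by simp [RelLetter.val]))

theorem exists_word_of_mem {x : G}
    (hx : x ∈ (X ∪ ⋃ l, (H l : Set G)) ∨ x⁻¹ ∈ (X ∪ ⋃ l, (H l : Set G))) :
    ∃ w : List (RelLetter H X), w.length ≤ 1 ∧ wordVal w = x := by
  have hH : ∀ l, x ∈ H l → ∃ w : List (RelLetter H X), w.length ≤ 1 ∧ wordVal w = x := by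
    intro l hl
    by_cases h1 : x = 1
    · exact ⟨[], by simp, by simp [h1]⟩
    · exact ⟨[.inl ⟨l, ⟨⟨x, hl⟩, by simpa [Subtype.ext_iff] using h1⟩⟩], by simp,
        by simp [RelLetter.val]⟩
  rcases hx with (hx | hx) | (hx | hx)
  · exact ⟨[.inr (⟨x, hx⟩, true)], by simp, by simp [RelLetter.val]⟩
  · obtain ⟨l, hl⟩ := Set.mem_iUnion.1 hx
    exact hH l hl
  · exact ⟨[.inr (⟨x⁻¹, hx⟩, false)], by simp, by simp [RelLetter.val]⟩
  · obtain ⟨l, hl⟩ := Set.mem_iUnion.1 hx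
    exact hH l (by simpa using hl)

theorem relDist_le (g : G) (w : List (RelLetter H X)) :
    relDist H X g (g * wordVal w) ≤ w.length := by
  refine Nat.sInf_le ⟨w.map RelLetter.val, by simp, ?_, by simp [wordVal]⟩
  intro x hx
  obtain ⟨a, _, rfl⟩ := List.mem_map.1 hx
  exact a.val_mem

theorem exists_word_relDist (hsurj : Function.Surjective (relEps H X)) (g h : G) :
    ∃ w : List (RelLetter H X), w.length = relDist H X g h ∧ g * wordVal w = h := by
  have hle : ∃ w : List (RelLetter H X), w.length ≤ relDist H X g h ∧ g * wordVal w = h := by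
    have hne : {n | ∃ w : List G, w.length = n ∧ (∀ x ∈ w, x ∈ (X ∪ ⋃ l, (H l : Set G)) ∨
        x⁻¹ ∈ (X ∪ ⋃ l, (H l : Set G))) ∧ w.prod = g⁻¹ * h}.Nonempty := by
      obtain ⟨w, hw⟩ := exists_wordVal_eq hsurj (g⁻¹ * h)
      refine ⟨_, w.map RelLetter.val, rfl, ?_, hw⟩
      intro x hx
      obtain ⟨a, _, rfl⟩ := List.mem_map.1 hx
      exact a.val_mem
    obtain ⟨v, hv, hvS, hvp⟩ := Nat.sInf_mem hne
    have key : ∀ v : List G, (∀ x ∈ v, x ∈ (X ∪ ⋃ l, (H l : Set G)) ∨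
        x⁻¹ ∈ (X ∪ ⋃ l, (H l : Set G))) →
        ∃ w : List (RelLetter H X), w.length ≤ v.length ∧ wordVal w = v.prod := by
      intro v
      induction v with
      | nil => exact fun _ => ⟨[], by simp, by simp⟩
      | cons x v ih =>
        intro h
        obtain ⟨w, hw, hw'⟩ := ih fun y hy => h y (by simp [hy])
        obtain ⟨u, hu, hu'⟩ := exists_word_of_mem (h x (by simp))
        exact ⟨u ++ w, by simp; omega, by simp [hu', hw']⟩
    obtain ⟨w, hw, hw'⟩ := key v hvS
    exact ⟨w, by rw [hv] at hw; exact hw, by rw [hw', hvp]; group⟩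
  obtain ⟨w, hw, rfl⟩ := hle
  exact ⟨w, le_antisymm hw (relDist_le g w), rfl⟩

theorem relDist_le_iff (hsurj : Function.Surjective (relEps H X)) {g h : G} {n : ℕ} :
    relDist H X g h ≤ n ↔ ∃ w : List (RelLetter H X), w.length ≤ n ∧ g * wordVal w = h := by
  constructor
  · intro hn
    obtain ⟨w, hw, hw'⟩ := exists_word_relDist hsurj g h
    exact ⟨w, by omega, hw'⟩
  · rintro ⟨w, hw, rfl⟩
    exact (relDist_le g w).trans hw

theorem isGraphMetric_relDist (hsurj : Function.Surjective (relEps H X)) :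
    IsGraphMetric (relDist H X) where
  self x := by simpa using relDist_le x ([] : List (RelLetter H X))
  eq_of_zero x y h := by
    obtain ⟨w, hw, rfl⟩ := exists_word_relDist hsurj x y
    rw [h, List.length_eq_zero_iff] at hw
    simp [hw]
  symm := by
    have key : ∀ x y, relDist H X y x ≤ relDist H X x y := by
      intro x y
      obtain ⟨w, hw, rfl⟩ := exists_word_relDist hsurj x y
      obtain ⟨v, hv, hv'⟩ := exists_inv_word w
      refine (relDist_le_iff hsurj).2 ⟨v, by omega, ?_⟩
      rw [← relEps_wordToF, ← relEps_wordToF, hv', map_inv]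
      group
    exact fun x y => le_antisymm (key y x) (key x y)
  tri x y z := by
    obtain ⟨v, hv, rfl⟩ := exists_word_relDist hsurj x y
    obtain ⟨w, hw, rfl⟩ := exists_word_relDist hsurj (x * wordVal v) z
    rw [← hv, ← hw, ← List.length_append, mul_assoc, ← wordVal_append]
    exact relDist_le _ _
  step x y n h := by
    obtain ⟨w, hw, rfl⟩ := exists_word_relDist hsurj x y
    rcases w with _ | ⟨a, w⟩
    · rw [h] at hw
      simp at hw
    have h1 : relDist H X x (x * a.val) ≤ 1 := by simpa using relDist_le x [a]
    have h2 := relDist_le (x * a.val) w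
    rw [mul_assoc, ← wordVal_cons] at h2
    refine ⟨x * a.val, h1, le_antisymm (by rw [List.length_cons] at hw; omega) ?_⟩
    have h3 : relDist H X x (x * wordVal (a :: w)) ≤
        1 + relDist H X (x * a.val) (x * wordVal (a :: w)) := by
      obtain ⟨v, hv, hv'⟩ := exists_word_relDist hsurj (x * a.val) (x * wordVal (a :: w))
      refine (relDist_le_iff hsurj).2 ⟨a :: v, by rw [List.length_cons]; omega, ?_⟩
      rw [← hv', wordVal_cons, mul_assoc]
    omega

namespace RelPath

theorem vertex_eq (p : RelPath H X) (k : ℕ) : p.vertex k = p.start * wordVal (p.word.take k) :=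
  rfl

@[simp] theorem vertex_zero (p : RelPath H X) : p.vertex 0 = p.start := by simp [vertex_eq]

theorem vertex_add (p : RelPath H X) (i k : ℕ) :
    p.vertex (i + k) = p.vertex i * wordVal ((p.word.drop i).take k) := by
  rw [vertex_eq, vertex_eq, List.take_add, wordVal_append, mul_assoc]

theorem relDist_vertex_le (p : RelPath H X) {i j : ℕ} (hij : i ≤ j) :
    relDist H X (p.vertex i) (p.vertex j) ≤ j - i := by
  obtain ⟨k, rfl⟩ := Nat.exists_eq_add_of_le hij
  rw [vertex_add]
  refine (relDist_le _ _).trans ?_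
  simp

/-- The subpath of `p` from the `i`-th vertex consisting of `k` letters. -/
def sub (p : RelPath H X) (i k : ℕ) : RelPath H X := ⟨p.vertex i, (p.word.drop i).take k⟩

theorem sub_vertex (p : RelPath H X) {i k m : ℕ} (hm : m ≤ k) :
    (p.sub i k).vertex m = p.vertex (i + m) := by
  rw [vertex_add, vertex_eq, sub, List.take_take, min_eq_left hm]

theorem sub_len (p : RelPath H X) {i k : ℕ} (h : i + k ≤ p.len) : (p.sub i k).len = k := by
  simp only [len, sub, List.length_take, List.length_drop] at *
  omega

theorem sub_finish (p : RelPath H X) {i k : ℕ} (h : i + k ≤ p.len) :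
    (p.sub i k).finish = p.vertex (i + k) := by
  have := p.sub_len h
  rw [finish, show (p.sub i k).word.length = k from this, sub_vertex _ le_rfl]

end RelPath

theorem exists_geodesic (hsurj : Function.Surjective (relEps H X)) (g h : G) :
    ∃ p : RelPath H X, IsGeodesic p ∧ p.start = g ∧ p.finish = h := by
  obtain ⟨w, hw, hwv⟩ := exists_word_relDist hsurj g h
  refine ⟨⟨g, w⟩, ?_, rfl, by simpa [RelPath.finish, RelPath.vertex_eq] using hwv⟩
  set p : RelPath H X := ⟨g, w⟩ with hp
  intro i j hij hj
  refine le_antisymm ?_ (p.relDist_vertex_le hij)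
  have hd := isGraphMetric_relDist hsurj
  have h0 : p.vertex 0 = g := by simp [hp]
  have h1 : p.vertex p.len = h := by simpa [hp, RelPath.len, RelPath.vertex_eq] using hwv
  have h2 := p.relDist_vertex_le (Nat.zero_le i)
  have h3 := p.relDist_vertex_le hj
  have h4 := hd.tri g (p.vertex i) h
  have h5 := hd.tri (p.vertex i) (p.vertex j) h
  rw [h0] at h2
  rw [h1] at h3
  have h6 : p.len = relDist H X g h := hw
  omega

end Words

section Hyperbolic

variable {G : Type*} [Group G] {Λ : Type*} {H : Λ → Subgroup G} {X : Set G}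

theorem IsGeodesic.relDist_add {q : RelPath H X}
    (hq : IsGeodesic q) {j : ℕ} (hj : j ≤ q.len) :
    relDist H X q.start q.finish =
      relDist H X q.start (q.vertex j) + relDist H X (q.vertex j) q.finish := by
  have h1 := hq 0 j (by omega) hj
  have h2 := hq j q.len hj le_rfl
  have h3 := hq 0 q.len (by omega) le_rfl
  have hf : q.finish = q.vertex q.len := rfl
  rw [RelPath.vertex_zero] at h1 h3
  rw [hf]
  omega

/-- Dehn's algorithm: in a hyperbolic Cayley graph every nontrivial closed path has a non-geodesic
subpath of bounded length. -/
theorem exists_shortcut (hsurj : Function.Surjective (relEps H X))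
    (hhyp : CayleyHyperbolic H X) :
    ∃ K : ℕ, ∀ w : List (RelLetter H X), w ≠ [] → wordVal w = 1 →
      ∃ a u b u' : List (RelLetter H X), w = a ++ u ++ b ∧ u.length ≤ K ∧
        u'.length < u.length ∧ wordVal u' = wordVal u := by
  obtain ⟨δ, -, hthin⟩ := hhyp
  have hd := isGraphMetric_relDist hsurj
  set D := ⌈δ⌉₊ with hD
  have hle : ∀ x y, (relDist H X x y : ℝ) ≤ δ → relDist H X x y ≤ D := fun x y h => by
    exact_mod_cast h.trans (Nat.le_ceil δ)
  set m := 2 * D + 1 with hm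
  refine ⟨2 * m, fun w hw hw1 => ?_⟩
  by_contra! hcon
  set p : RelPath H X := ⟨1, w⟩ with hp
  have hlen : 0 < p.len := List.length_pos_iff.2 hw
  have hloc : ∀ i k, k ≤ 2 * m → i + k ≤ p.len →
      relDist H X (p.vertex i) (p.vertex (i + k)) = k := by
    intro i k hk hik
    refine le_antisymm ((p.relDist_vertex_le (Nat.le_add_right _ _)).trans (by omega)) ?_
    by_contra! hlt
    obtain ⟨u', hu', hv⟩ := exists_word_relDist hsurj (p.vertex i) (p.vertex (i + k))
    have hul : ((w.drop i).take k).length = k := p.sub_len hik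
    refine hcon (w.take i) ((w.drop i).take k) ((w.drop i).drop k) u' ?_ (by omega) (by omega) ?_
    · rw [List.append_assoc, List.take_append_drop, List.take_append_drop]
    · rw [p.vertex_add] at hv
      exact mul_left_cancel hv
  have hgeo : ∀ i k, k ≤ 2 * m → i + k ≤ p.len → IsGeodesic (p.sub i k) := by
    intro i k hk hik s t hst ht
    rw [p.sub_len hik] at ht
    obtain ⟨r, rfl⟩ := Nat.exists_eq_add_of_le hst
    rw [p.sub_vertex (by omega), p.sub_vertex ht, ← add_assoc, hloc _ _ (by omega) (by omega)]
    omega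
  have hstart : p.vertex 0 = 1 := by simp [hp]
  have hend : p.vertex p.len = 1 := by simpa [hp, RelPath.len, RelPath.vertex_eq] using hw1
  obtain ⟨i, hi, hmax⟩ := Finset.exists_max_image (Finset.range (p.len + 1))
    (fun i => relDist H X 1 (p.vertex i)) ⟨0, by simp⟩
  have hi : i ≤ p.len := by simpa [Nat.lt_succ_iff] using hi
  have hmax : ∀ j ≤ p.len, relDist H X 1 (p.vertex j) ≤ relDist H X 1 (p.vertex i) :=
    fun j hj => hmax j (by simpa [Nat.lt_succ_iff] using hj)
  have hlong : 2 * m < p.len := by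
    by_contra! h
    have := hloc 0 p.len h (by omega)
    rw [zero_add, hstart, hend, hd.self] at this
    omega
  rcases lt_or_ge i m with h | h
  · have h1 := hloc 0 i (by omega) (by omega)
    have h2 := hloc 0 (i + 1) (by omega) (by omega)
    have h3 := hmax (i + 1) (by omega)
    rw [zero_add, hstart] at h1 h2
    omega
  rcases lt_or_ge p.len (i + m) with h' | h'
  · have h1 := hloc i (p.len - i) (by omega) (by omega)
    have h2 := hloc (i - 1) (p.len - (i - 1)) (by omega) (by omega)
    have h3 := hmax (i - 1) (by omega)
    rw [show i + (p.len - i) = p.len by omega, hend, hd.symm] at h1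
    rw [show i - 1 + (p.len - (i - 1)) = p.len by omega, hend, hd.symm] at h2
    omega
  have hsl : i - m + 2 * m ≤ p.len := by omega
  obtain ⟨q, hq, hqs, hqf⟩ := exists_geodesic hsurj (p.sub (i - m) (2 * m)).finish 1
  obtain ⟨r, hr, hrs, hrf⟩ := exists_geodesic hsurj 1 (p.sub (i - m) (2 * m)).start
  obtain ⟨j, hj⟩ := hthin _ q r (hgeo (i - m) (2 * m) le_rfl hsl) hq hr hqs.symm
    (hqf.trans hrs.symm) hrf m (by rw [p.sub_len hsl]; omega)
  rw [p.sub_vertex (by omega), show i - m + m = i by omega] at hj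
  rw [p.sub_finish hsl] at hqs
  have hrf : r.finish = p.vertex (i - m) := hrf
  rcases hj with ⟨hj, hj'⟩ | ⟨hj, hj'⟩
  · have h1 := hle _ _ hj'
    have h2 := hq.relDist_add hj
    rw [hqs, hqf] at h2
    have h3 := hmax (i - m + 2 * m) hsl
    have h4 := hloc i m (by omega) h'
    rw [show i + m = i - m + 2 * m by omega] at h4
    have h5 := hd.tri (p.vertex i) (q.vertex j) (p.vertex (i - m + 2 * m))
    have h6 := hd.tri 1 (q.vertex j) (p.vertex i)
    rw [hd.symm _ 1, hd.symm _ (q.vertex j), hd.symm _ 1] at h2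
    rw [hd.symm (q.vertex j) (p.vertex i)] at h6
    omega
  · have h1 := hle _ _ hj'
    have h2 := hr.relDist_add hj
    rw [hrs, hrf] at h2
    have h3 := hmax (i - m) (by omega)
    have h4 := hloc (i - m) m (by omega) (by omega)
    rw [show i - m + m = i by omega, hd.symm] at h4
    have h5 := hd.tri (p.vertex i) (r.vertex j) (p.vertex (i - m))
    have h6 := hd.tri 1 (r.vertex j) (p.vertex i)
    rw [hd.symm (r.vertex j) (p.vertex i)] at h6
    omega

/-- `u` is a product of at most `n` conjugates of elements of `R`. -/
def AreaLE (R : Set (RelFree H X)) (n : ℕ) (u : RelFree H X) : Prop :=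
  ∃ k ≤ n, ∃ r c : Fin k → RelFree H X,
    (∀ i, r i ∈ R) ∧ u = (List.ofFn fun i => (c i)⁻¹ * r i * c i).prod

namespace AreaLE

variable {R : Set (RelFree H X)}

theorem one (n : ℕ) : AreaLE R n 1 :=
  ⟨0, by omega, Fin.elim0, Fin.elim0, fun i => i.elim0, by simp⟩

theorem mul {n m : ℕ} {u v : RelFree H X} (hu : AreaLE R n u) (hv : AreaLE R m v) :
    AreaLE R (n + m) (u * v) := by
  obtain ⟨k, hk, r, c, hr, rfl⟩ := hu
  obtain ⟨k', hk', r', c', hr', rfl⟩ := hv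
  refine ⟨k + k', by omega, Fin.append r r', Fin.append c c', ?_, ?_⟩
  · intro i
    refine Fin.addCases (fun i => ?_) (fun i => ?_) i
    · simpa using hr i
    · simpa using hr' i
  · rw [List.ofFn_add, List.prod_append]
    simp

theorem conj {n : ℕ} {u : RelFree H X} (hu : AreaLE R n u) (g : RelFree H X) :
    AreaLE R n (g * u * g⁻¹) := by
  obtain ⟨k, hk, r, c, hr, rfl⟩ := hu
  refine ⟨k, hk, r, fun i => c i * g⁻¹, hr, ?_⟩
  rw [← MulAut.conj_apply, map_list_prod, List.map_ofFn]
  congr 2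
  ext1 i
  simp [mul_assoc]

theorem mono {n m : ℕ} {u : RelFree H X} (hu : AreaLE R n u) (h : n ≤ m) : AreaLE R m u := by
  obtain ⟨k, hk, hu⟩ := hu
  exact ⟨k, by omega, hu⟩

end AreaLE

theorem IsRelHyperbolic.of_cayleyHyperbolic {R : Set (RelFree H X)}
    (hpres : IsFiniteRelPres H X R) (hwd : DehnWellDefined H X R)
    (hhyp : CayleyHyperbolic H X) : IsRelHyperbolic H := by
  obtain ⟨f, hf⟩ := hwd
  obtain ⟨K, hK⟩ := exists_shortcut hpres.surj hhyp
  set A := ∑ i ∈ Finset.range (2 * K + 1), f i with hA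
  have hfA : ∀ i ≤ 2 * K, f i ≤ A := fun i hi =>
    Finset.single_le_sum (f := f) (fun _ _ => Nat.zero_le _) (by simp; omega)
  have main : ∀ n (w : List (RelLetter H X)), w.length ≤ n → wordVal w = 1 →
      AreaLE R (A * n) (wordToF w) := by
    intro n
    induction n with
    | zero =>
      intro w hw _
      rw [List.length_eq_zero_iff.1 (Nat.le_zero.1 hw)]
      exact .one _
    | succ n ih =>
      intro w hwn hw1
      by_cases hw : w = []
      · subst hw; exact .one _
      obtain ⟨a, u, b, u', rfl, hu, hlt, hval⟩ := hK w hw hw1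
      obtain ⟨v, hv, hvF⟩ := exists_inv_word u'
      have h1 : AreaLE R A (wordToF (u ++ v)) := by
        have : AreaLE R (f (u ++ v).length) (wordToF (u ++ v)) := by
          apply hf
          rw [wordToF_append, hvF, map_mul, map_inv, relEps_wordToF, relEps_wordToF, hval,
            mul_inv_cancel]
        refine this.mono (hfA _ ?_)
        rw [List.length_append]; omega
      have h2 : AreaLE R (A * n) (wordToF (a ++ u' ++ b)) := by
        refine ih _ ?_ ?_
        · simp only [List.length_append] at hwn ⊢; omega
        · simpa [hval] using hw1
      have h3 := (h1.conj (wordToF a)).mul h2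
      rw [show A + A * n = A * (n + 1) by ring] at h3
      convert h3 using 1
      simp only [wordToF_append, hvF]
      group
  refine ⟨X, R, hpres, A, 0, fun w hw => ?_⟩
  rw [relEps_wordToF] at hw
  exact main _ w le_rfl hw

end Hyperbolic

section Stokes

variable {G : Type*} [Group G] {Λ : Type*} {H : Λ → Subgroup G} {X : Set G}

/-- The semidirect product of the additive group of functions `G → ℝ` with `G` acting
by right translation. -/
@[ext] structure TranslationExt (G : Type*) where
  form : G → ℝ
  pos : G

namespace TranslationExt

instance : One (TranslationExt G) := ⟨⟨fun _ => 0, 1⟩⟩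

instance : Mul (TranslationExt G) :=
  ⟨fun a b => ⟨fun x => a.form x + b.form (x * a.pos), a.pos * b.pos⟩⟩

instance : Inv (TranslationExt G) := ⟨fun a => ⟨fun x => -a.form (x * a.pos⁻¹), a.pos⁻¹⟩⟩

@[simp] theorem one_form (x : G) : (1 : TranslationExt G).form x = 0 := rfl

@[simp] theorem one_pos : (1 : TranslationExt G).pos = 1 := rfl

@[simp] theorem mul_form (a b : TranslationExt G) (x : G) :
    (a * b).form x = a.form x + b.form (x * a.pos) := rfl

@[simp] theorem mul_pos (a b : TranslationExt G) : (a * b).pos = a.pos * b.pos := rfl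

@[simp] theorem inv_form (a : TranslationExt G) (x : G) :
    a⁻¹.form x = -a.form (x * a.pos⁻¹) := rfl

@[simp] theorem inv_pos (a : TranslationExt G) : a⁻¹.pos = a.pos⁻¹ := rfl

instance : Group (TranslationExt G) :=
  Group.ofLeftAxioms
    (fun a b c => by ext <;> simp [mul_assoc, add_assoc])
    (fun a => by ext <;> simp)
    (fun a => by ext <;> simp)

/-- The projection onto `G`. -/
def posHom : TranslationExt G →* G where
  toFun := pos
  map_one' := rfl
  map_mul' _ _ := rfl

theorem abs_form_conj_prod_le {M : ℝ} {k : ℕ} (r c : Fin k → TranslationExt G)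
    (hpos : ∀ i, (r i).pos = 1) (hr : ∀ i x, |(r i).form x| ≤ M) (x : G) :
    |(List.ofFn fun i => (c i)⁻¹ * r i * c i).prod.form x| ≤ k * M := by
  induction k generalizing x with
  | zero => simp
  | succ k ih =>
    have h := ih (fun i => r i.succ) (fun i => c i.succ) (fun i => hpos _) (fun i => hr _) x
    have h0 := hr 0 (x * (c 0).pos⁻¹)
    rw [List.ofFn_succ, List.prod_cons, mul_form]
    have e : ((c 0)⁻¹ * r 0 * c 0).form x = (r 0).form (x * (c 0).pos⁻¹) := by
      simp [hpos]
    have e' : ((c 0)⁻¹ * r 0 * c 0).pos = 1 := by simp [hpos]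
    rw [e, e', mul_one]
    refine (abs_add_le _ _).trans ?_
    push_cast
    linarith

end TranslationExt

open TranslationExt in
/-- The cocycle on the free product which approximates the `1`-form `f dg` and which is
exact on every coset of the subgroups `H l`. -/
noncomputable def stokesHom (H : Λ → Subgroup G) (X : Set G) (f g : G → ℝ) :
    RelFree H X →* TranslationExt G :=
  Monoid.Coprod.lift
    (Monoid.CoprodI.lift fun l =>
      { toFun := fun h => ⟨fun x => f (x : G ⧸ H l).out * (g (x * h) - g x), h⟩
        map_one' := by ext <;> simp
        map_mul' := fun h k => by
          ext x
          · have : ((x * h : G) : G ⧸ H l) = x := QuotientGroup.mk_mul_of_mem x h.2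
            simp only [mul_form, this, Subgroup.coe_mul, mul_assoc]
            ring
          · simp })
    (FreeGroup.lift fun y => ⟨fun x => f x * (g (x * y) - g x), y⟩)

theorem stokesHom_pos (f g : G → ℝ) (u : RelFree H X) :
    (stokesHom H X f g u).pos = relEps H X u := by
  suffices h : TranslationExt.posHom.comp (stokesHom H X f g) = relEps H X from
    DFunLike.congr_fun h u
  refine Monoid.Coprod.hom_ext ?_ ?_
  · refine Monoid.CoprodI.ext_hom _ _ fun l => ?_
    ext h
    simp [stokesHom, relEps, TranslationExt.posHom]
  · ext y
    simp [stokesHom, relEps, TranslationExt.posHom]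

theorem abs_stokesHom_letter_sub_le {f g : G → ℝ} {L : ℝ}
    (hL : 0 ≤ L) (hf : ∀ x (a : RelLetter H X), |f (x * a.val) - f x| ≤ L)
    (hg : ∀ x (a : RelLetter H X), |g (x * a.val) - g x| ≤ L) (a : RelLetter H X) (x : G) :
    |(stokesHom H X f g a.toF).form x - f x * (g (x * a.val) - g x)| ≤ L ^ 2 := by
  rcases a with ⟨l, h⟩ | ⟨y, b⟩
  · have e : (stokesHom H X f g (RelLetter.toF (.inl ⟨l, h⟩))).form x =
        f (x : G ⧸ H l).out * (g (x * h.1) - g x) := by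
      simp [stokesHom, RelLetter.toF]
    have hout : |f (x : G ⧸ H l).out - f x| ≤ L := by
      obtain ⟨k, hk⟩ := QuotientGroup.mk_out_eq_mul (H l) x
      rw [hk]
      by_cases h1 : k = 1
      · simpa [h1] using hL
      · exact hf x (.inl ⟨l, ⟨k, h1⟩⟩)
    have hgx := hg x (.inl ⟨l, h⟩)
    rw [e]
    simp only [RelLetter.val] at hgx ⊢
    rw [← sub_mul, abs_mul, sq]
    exact mul_le_mul hout hgx (abs_nonneg _) hL
  · cases b
    · have e : (stokesHom H X f g (RelLetter.toF (.inr (y, false)))).form x =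
          f (x * (y : G)⁻¹) * (g (x * (y : G)⁻¹) - g x) := by
        simp [stokesHom, RelLetter.toF]
        ring
      have hfx := hf x (.inr (y, false))
      have hgx := hg x (.inr (y, false))
      rw [e]
      simp only [RelLetter.val, Bool.false_eq_true, if_false] at hfx hgx ⊢
      rw [← sub_mul, abs_mul, sq]
      exact mul_le_mul hfx hgx (abs_nonneg _) hL
    · have e : (stokesHom H X f g (RelLetter.toF (.inr (y, true)))).form x =
          f x * (g (x * y) - g x) := by
        simp [stokesHom, RelLetter.toF]
      rw [e]
      simp only [RelLetter.val, if_true, sub_self, abs_zero]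
      positivity

theorem abs_wordVal_sub_le {g : G → ℝ} {L : ℝ}
    (hg : ∀ x (a : RelLetter H X), |g (x * a.val) - g x| ≤ L) (w : List (RelLetter H X)) (x : G) :
    |g (x * wordVal w) - g x| ≤ L * w.length := by
  induction w generalizing x with
  | nil => simp
  | cons a w ih =>
    have h1 := hg x a
    have h2 := ih (x * a.val)
    rw [wordVal_cons, ← mul_assoc]
    have h3 := abs_sub_le (g (x * a.val * wordVal w)) (g (x * a.val)) (g x)
    rw [List.length_cons]
    push_cast
    linarith

theorem abs_stokesHom_word_sub_le {f g : G → ℝ} {L : ℝ}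
    (hL : 0 ≤ L) (hf : ∀ x (a : RelLetter H X), |f (x * a.val) - f x| ≤ L)
    (hg : ∀ x (a : RelLetter H X), |g (x * a.val) - g x| ≤ L) (w : List (RelLetter H X)) (x : G) :
    |(stokesHom H X f g (wordToF w)).form x - f x * (g (x * wordVal w) - g x)| ≤
      L ^ 2 * w.length ^ 2 := by
  induction w generalizing x with
  | nil => simp
  | cons a w ih =>
    have h1 := abs_stokesHom_letter_sub_le hL hf hg a x
    have h2 := ih (x * a.val)
    have h3 := abs_wordVal_sub_le hg w (x * a.val)
    have h4 := mul_le_mul (hf x a) h3 (abs_nonneg _) hL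
    rw [← abs_mul] at h4
    have e : (stokesHom H X f g (wordToF (a :: w))).form x =
        (stokesHom H X f g a.toF).form x + (stokesHom H X f g (wordToF w)).form (x * a.val) := by
      rw [wordToF_cons, map_mul, TranslationExt.mul_form, stokesHom_pos, RelLetter.relEps_toF]
    rw [e, wordVal_cons, ← mul_assoc, List.length_cons]
    push_cast
    have e2 : (stokesHom H X f g a.toF).form x + (stokesHom H X f g (wordToF w)).form (x * a.val) -
        f x * (g (x * a.val * wordVal w) - g x) =
        ((stokesHom H X f g a.toF).form x - f x * (g (x * a.val) - g x)) +
        ((stokesHom H X f g (wordToF w)).form (x * a.val) -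
          f (x * a.val) * (g (x * a.val * wordVal w) - g (x * a.val))) +
        (f (x * a.val) - f x) * (g (x * a.val * wordVal w) - g (x * a.val)) := by ring
    rw [e2]
    refine (abs_add_three _ _ _).trans ?_
    have h5 : 0 ≤ L ^ 2 * (w.length : ℝ) := by positivity
    nlinarith

theorem exists_relDist_letter_le {X' : Set G} (hsurj : Function.Surjective (relEps H X))
    (hfin : X'.Finite) :
    ∃ L : ℕ, ∀ (x : G) (a : RelLetter H X'), relDist H X x (x * a.val) ≤ L := by
  have hd := isGraphMetric_relDist hsurj
  obtain ⟨L, hL⟩ := (hfin.image fun y => relDist H X 1 y).bddAbove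
  have hinv : ∀ x y : G, relDist H X x (x * y) = relDist H X 1 y := fun x y => by
    simp [relDist]
  have hX : ∀ y ∈ X', ∀ x, relDist H X x (x * y) ≤ L := fun y hy x => by
    rw [hinv]; exact hL ⟨y, hy, rfl⟩
  refine ⟨L + 1, fun x a => ?_⟩
  rcases a with ⟨l, h⟩ | ⟨y, b⟩
  · have := relDist_le x ([.inl ⟨l, h⟩] : List (RelLetter H X))
    simp [RelLetter.val] at this ⊢
    omega
  · cases b
    · have := hX y y.2 (x * (y : G)⁻¹)
      rw [hd.symm] at this
      simp [RelLetter.val] at this ⊢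
      omega
    · have := hX y y.2 x
      simp [RelLetter.val]
      omega

theorem exists_word_pathIntegral {X' : Set G} (hsurj : Function.Surjective (relEps H X))
    (hsurj' : Function.Surjective (relEps H X')) {L₀ : ℕ}
    (hL₀ : ∀ (x : G) (a : RelLetter H X), relDist H X' x (x * a.val) ≤ L₀) {f g : G → ℝ} {L : ℝ}
    (hL : 0 ≤ L) (hf : ∀ x (a : RelLetter H X'), |f (x * a.val) - f x| ≤ L)
    (hg : ∀ x (a : RelLetter H X'), |g (x * a.val) - g x| ≤ L) {n : ℕ} {x y : G} {s : ℝ}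
    (hp : PathIntegral (relDist H X) f g n x y s) :
    ∃ w : List (RelLetter H X'), w.length ≤ L₀ * n ∧ x * wordVal w = y ∧
      |(stokesHom H X' f g (wordToF w)).form x - s| ≤ L ^ 2 * L₀ ^ 2 * n := by
  induction hp with
  | nil x => exact ⟨[], by simp, by simp, by simp⟩
  | @cons n x y z s hxy _ ih =>
    obtain ⟨w, hw, rfl, hws⟩ := ih
    have hxy' : relDist H X' x y ≤ L₀ := by
      obtain ⟨v, hv, rfl⟩ := (relDist_le_iff hsurj).1 hxy
      rcases v with _ | ⟨a, _ | ⟨b, v⟩⟩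
      · simp [(isGraphMetric_relDist hsurj').self]
      · simpa using hL₀ x a
      · simp at hv
    obtain ⟨v, hv, rfl⟩ := (relDist_le_iff hsurj').1 hxy'
    refine ⟨v ++ w, ?_, by simp [mul_assoc], ?_⟩
    · rw [List.length_append, mul_add]; omega
    · have h1 := abs_stokesHom_word_sub_le hL hf hg v x
      have e : (stokesHom H X' f g (wordToF (v ++ w))).form x =
          (stokesHom H X' f g (wordToF v)).form x +
            (stokesHom H X' f g (wordToF w)).form (x * wordVal v) := by
        rw [wordToF_append, map_mul, TranslationExt.mul_form, stokesHom_pos, relEps_wordToF]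
      rw [e, add_sub_add_comm]
      refine (abs_add_le _ _).trans ?_
      have h2 : L ^ 2 * (v.length : ℝ) ^ 2 ≤ L ^ 2 * (L₀ : ℝ) ^ 2 := by gcongr
      push_cast
      linarith

theorem linearStokes_relDist (hsurj : Function.Surjective (relEps H X)) (hX : X.Finite)
    (hhyp : IsRelHyperbolic H) : ∃ C, LinearStokes (relDist H X) C := by
  obtain ⟨X', R, hpres, A, B, hiso⟩ := hhyp
  obtain ⟨L₀, hL₀⟩ := exists_relDist_letter_le hpres.surj hX
  obtain ⟨L, hL⟩ := exists_relDist_letter_le hsurj hpres.finX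
  have hd := isGraphMetric_relDist hsurj
  choose word hword using exists_word (H := H) (X := X')
  obtain ⟨m, hm⟩ := (hpres.finR.image fun r => (word r).length).bddAbove
  set M : ℝ := (L : ℝ) ^ 2 * (m : ℝ) ^ 2 with hM
  refine ⟨(A * L₀ + B) * M + (L : ℝ) ^ 2 * L₀ ^ 2, fun f g hf hg n x s hp => ?_⟩
  have hlip : ∀ {f : G → ℝ}, (∀ x y, |f x - f y| ≤ relDist H X x y) →
      ∀ x (a : RelLetter H X'), |f (x * a.val) - f x| ≤ (L : ℝ) := by
    intro f hf x a
    refine (hf _ _).trans ?_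
    rw [hd.symm]
    exact_mod_cast hL x a
  have hL0 : (0 : ℝ) ≤ L := Nat.cast_nonneg _
  obtain ⟨w, hw, hwx, hws⟩ :=
    exists_word_pathIntegral hsurj hpres.surj hL₀ hL0 (hlip hf) (hlip hg) hp
  have hw1 : relEps H X' (wordToF w) = 1 := by
    rw [relEps_wordToF]; exact mul_eq_left.1 hwx
  obtain ⟨k, hk, r, c, hr, hprod⟩ := hiso w hw1
  have hr1 : ∀ i, relEps H X' (r i) = 1 := fun i => by
    rw [← MonoidHom.mem_ker, hpres.ker]
    exact Subgroup.subset_normalClosure (hr i)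
  have hrM : ∀ i y, |(stokesHom H X' f g (r i)).form y| ≤ M := by
    intro i y
    have h := abs_stokesHom_word_sub_le hL0 (hlip hf) (hlip hg) (word (r i)) y
    rw [← relEps_wordToF, hword, hr1, mul_one, sub_self, mul_zero, sub_zero] at h
    refine h.trans ?_
    have : (word (r i)).length ≤ m := hm ⟨_, hr i, rfl⟩
    rw [hM]
    gcongr
  have hform := TranslationExt.abs_form_conj_prod_le (fun i => stokesHom H X' f g (r i))
    (fun i => stokesHom H X' f g (c i)) (fun i => by rw [stokesHom_pos, hr1]) hrM x
  have e : stokesHom H X' f g (wordToF w) = (List.ofFn fun i =>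
      (stokesHom H X' f g (c i))⁻¹ * stokesHom H X' f g (r i) * stokesHom H X' f g (c i)).prod := by
    rw [hprod, map_list_prod, List.map_ofFn]
    congr 2
    ext1 i
    simp
  rw [← e] at hform
  have hk' : (k : ℝ) ≤ (A * L₀ + B) * (n + 1) := by
    have h1 : k ≤ A * (L₀ * n) + B := hk.trans (Nat.add_le_add_right (Nat.mul_le_mul_left A hw) B)
    have h2 : (k : ℝ) ≤ A * (L₀ * n) + B := by exact_mod_cast h1
    have h3 : (0 : ℝ) ≤ A * L₀ := by positivity
    have h4 : (0 : ℝ) ≤ B * n := by positivity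
    linarith
  have hM0 : 0 ≤ M := by positivity
  have h5 := mul_le_mul_of_nonneg_right hk' hM0
  have h6 : |s| ≤ |(stokesHom H X' f g (wordToF w)).form x| +
      |(stokesHom H X' f g (wordToF w)).form x - s| := by
    have := abs_sub_abs_le_abs_sub s ((stokesHom H X' f g (wordToF w)).form x)
    rw [abs_sub_comm] at this
    linarith
  have h7 : (0 : ℝ) ≤ (L : ℝ) ^ 2 * L₀ ^ 2 := by positivity
  linarith

theorem CayleyHyperbolic.of_isRelHyperbolic (hsurj : Function.Surjective (relEps H X))
    (hX : X.Finite) (hhyp : IsRelHyperbolic H) : CayleyHyperbolic H X := by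
  obtain ⟨C, hC⟩ := linearStokes_relDist hsurj hX hhyp
  obtain ⟨D, hD⟩ := hC.exists_thin (isGraphMetric_relDist hsurj)
  refine ⟨D, Nat.cast_nonneg _, fun p q r hp hq hr hpq hqr hrp i hi => ?_⟩
  have hgeo : ∀ {p : RelPath H X}, IsGeodesic p → IsGeod (relDist H X) p.vertex p.len :=
    fun hp i j hij hj => (hp i j hij hj).symm
  have := hD p.vertex q.vertex r.vertex p.len q.len r.len (hgeo hp) (hgeo hq) (hgeo hr)
    (hpq.trans q.vertex_zero.symm) (hqr.trans r.vertex_zero.symm) (hrp.trans p.vertex_zero.symm)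
  rcases this i hi with ⟨j, hj, h⟩ | ⟨j, hj, h⟩
  · exact ⟨j, .inl ⟨hj, by exact_mod_cast h⟩⟩
  · exact ⟨j, .inr ⟨hj, by exact_mod_cast h⟩⟩

end Stokes

end RelHyp

/-- Theorem 1.7 / Corollary 2.52. Suppose `G` is finitely presented relative
to `{H_λ}` with finite relative generating set `X` and the relative Dehn function is
well-defined. Then `G` is hyperbolic relative to `{H_λ}` iff the Cayley graph `Γ(G, X ∪ 𝓗)` is
a hyperbolic metric space. -/
theorem statement_6 {G : Type*} [Group G] {Λ : Type*} (H : Λ → Subgroup G)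
    (X : Set G) (R : Set (RelFree H X)) (hpres : IsFiniteRelPres H X R)
    (hwd : DehnWellDefined H X R) :
    IsRelHyperbolic H ↔ CayleyHyperbolic H X := by
  exact ⟨.of_isRelHyperbolic hpres.surj hpres.finX, .of_cayleyHyperbolic hpres hwd⟩
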